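/- arXiv:2109.08398 — 2 statements merged into one kernel-verified Lean document; each statement's English description precedes it below -/
import Mathlib

section
/- Let k > 0, assume that every vertex of G is incident with at least one edge and that G has at least 128k edges. Let τ be a tangle of S_{64k}(X), let τ' := ^▷τ ∩ S_{8k}(Y), and let τ'' := ^◁τ' ∩ S_k(X). Then τ'' ⊆ τ. -/
open Finset

namespace BipSep

variable {X Y : Type*} [Fintype X] [Fintype Y] [DecidableEq X] [DecidableEq Y]

/-- `|N(y) ∩ A|`: the number of neighbours of `y` in `A ⊆ X`, where the bipartite graph is
given by the adjacency relation `R : X → Y → Prop`. -/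
def nX (R : X → Y → Prop) [∀ x y, Decidable (R x y)] (y : Y) (A : Finset X) : ℕ :=
  (A.filter fun x => R x y).card

/-- `|N(x) ∩ C|` for `C ⊆ Y`. -/
def nY (R : X → Y → Prop) [∀ x y, Decidable (R x y)] (x : X) (C : Finset Y) : ℕ :=
  (C.filter fun y => R x y).card

/-- The order `|A,B|_X` of a separation `(A,B)` of `X`. -/
def ordX (R : X → Y → Prop) [∀ x y, Decidable (R x y)] (A B : Finset X) : ℚ :=
  ∑ y : Y, ((min (nX R y A) (nX R y B) : ℚ) - (nX R y (A ∩ B) : ℚ) / 2)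

/-- The order `|C,D|_Y` of a separation `(C,D)` of `Y`. -/
def ordY (R : X → Y → Prop) [∀ x y, Decidable (R x y)] (C D : Finset Y) : ℚ :=
  ∑ x : X, ((min (nY R x C) (nY R x D) : ℚ) - (nY R x (C ∩ D) : ℚ) / 2)

/-- `A^▷_B := {y ∈ Y : |N(y) ∩ A| ≥ |N(y) ∩ B|}`. -/
def shiftR1 (R : X → Y → Prop) [∀ x y, Decidable (R x y)] (A B : Finset X) : Finset Y :=
  univ.filter fun y => nX R y B ≤ nX R y A

/-- `B^▷_A := {y ∈ Y : |N(y) ∩ A| ≤ |N(y) ∩ B|}`. -/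
def shiftR2 (R : X → Y → Prop) [∀ x y, Decidable (R x y)] (A B : Finset X) : Finset Y :=
  univ.filter fun y => nX R y A ≤ nX R y B

/-- `C^◁_D := {x ∈ X : |N(x) ∩ C| ≥ |N(x) ∩ D|}`. -/
def shiftL1 (R : X → Y → Prop) [∀ x y, Decidable (R x y)] (C D : Finset Y) : Finset X :=
  univ.filter fun x => nY R x D ≤ nY R x C

/-- `D^◁_C := {x ∈ X : |N(x) ∩ C| ≤ |N(x) ∩ D|}`. -/
def shiftL2 (R : X → Y → Prop) [∀ x y, Decidable (R x y)] (C D : Finset Y) : Finset X :=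
  univ.filter fun x => nY R x C ≤ nY R x D

instance (R : X → Y → Prop) [∀ x y, Decidable (R x y)] :
    DecidablePred fun p : X × Y => R p.1 p.2 :=
  fun p => inferInstanceAs (Decidable (R p.1 p.2))

/-- The edge set of the bipartite graph with adjacency relation `R`: an edge is a pair
`(x,y)` with `x ∈ X`, `y ∈ Y` and `x` adjacent to `y`. -/
abbrev Edge (R : X → Y → Prop) := {p : X × Y // R p.1 p.2}

/-- `|E(x) ∩ C|` for a set `C` of edges. -/
def eX (R : X → Y → Prop) [∀ x y, Decidable (R x y)] (x : X) (C : Finset (Edge R)) : ℕ :=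
  (C.filter fun e => e.1.1 = x).card

/-- `|E(y) ∩ C|` for a set `C` of edges. -/
def eY (R : X → Y → Prop) [∀ x y, Decidable (R x y)] (y : Y) (C : Finset (Edge R)) : ℕ :=
  (C.filter fun e => e.1.2 = y).card

/-- The order `|C,D|_E` of a separation `(C,D)` of the edge set `E`. -/
def ordE (R : X → Y → Prop) [∀ x y, Decidable (R x y)] (C D : Finset (Edge R)) : ℚ :=
  (∑ x : X, ((min (eX R x C) (eX R x D) : ℚ) - (eX R x (C ∩ D) : ℚ) / 2)) +
    ∑ y : Y, ((min (eY R y C) (eY R y D) : ℚ) - (eY R y (C ∩ D) : ℚ) / 2)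

/-- `C^◀_D := {x ∈ X : |E(x) ∩ C| ≥ |E(x) ∩ D|}`. -/
def bshift1 (R : X → Y → Prop) [∀ x y, Decidable (R x y)] (C D : Finset (Edge R)) : Finset X :=
  univ.filter fun x => eX R x D ≤ eX R x C

/-- `D^◀_C := {x ∈ X : |E(x) ∩ C| ≤ |E(x) ∩ D|}`. -/
def bshift2 (R : X → Y → Prop) [∀ x y, Decidable (R x y)] (C D : Finset (Edge R)) : Finset X :=
  univ.filter fun x => eX R x C ≤ eX R x D

/-- `E(A)`: the set of edges with an endpoint in `A ⊆ X`. -/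
def edgesOf (R : X → Y → Prop) [∀ x y, Decidable (R x y)] (A : Finset X) : Finset (Edge R) :=
  univ.filter fun e => e.1.1 ∈ A

/-- `|E(S,T)|`: the number of edges with `X`-endpoint in `T` and `Y`-endpoint in `S`. -/
def eCount (R : X → Y → Prop) [∀ x y, Decidable (R x y)] (T : Finset X) (S : Finset Y) : ℕ :=
  (univ.filter fun e : Edge R => e.1.1 ∈ T ∧ e.1.2 ∈ S).card

/-- `S_k`: the set of oriented separations of order `< k`, with respect to the
order function `ord`. -/
def Sk {V : Type*} [Fintype V] [DecidableEq V] (ord : Finset V → Finset V → ℚ) (k : ℚ) :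
    Set (Finset V × Finset V) :=
  {p | p.1 ∪ p.2 = univ ∧ ord p.1 p.2 < k}

/-- A tangle of `S_k`: a set of oriented separations, all of order `< k`, containing exactly
one of `(A,B)`, `(B,A)` for every separation of order `< k`, such that no three of its
members have their left-hand sides covering the whole ground set. -/
def IsTangle {V : Type*} [Fintype V] [DecidableEq V] (ord : Finset V → Finset V → ℚ)
    (k : ℚ) (τ : Set (Finset V × Finset V)) : Prop :=
  (∀ p ∈ τ, p.1 ∪ p.2 = univ ∧ ord p.1 p.2 < k) ∧
  (∀ A B : Finset V, A ∪ B = univ → ord A B < k → ((A, B) ∈ τ ↔ (B, A) ∉ τ)) ∧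
  ∀ p₁ ∈ τ, ∀ p₂ ∈ τ, ∀ p₃ ∈ τ, p₁.1 ∪ p₂.1 ∪ p₃.1 ≠ univ

/-- A profile of `S_k`: an orientation of `S_k` that is consistent and closed under
the profile property. -/
def IsProfile {V : Type*} [Fintype V] [DecidableEq V] (ord : Finset V → Finset V → ℚ)
    (k : ℚ) (P : Set (Finset V × Finset V)) : Prop :=
  (∀ p ∈ P, p.1 ∪ p.2 = univ ∧ ord p.1 p.2 < k) ∧
  (∀ A B : Finset V, A ∪ B = univ → ord A B < k → ((A, B) ∈ P ↔ (B, A) ∉ P)) ∧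
  (∀ A₁ B₁ A₂ B₂ : Finset V, A₁ ⊆ A₂ → B₂ ⊆ B₁ →
    ¬((A₁ = A₂ ∧ B₁ = B₂) ∨ (A₁ = B₂ ∧ B₁ = A₂)) →
    ¬((B₁, A₁) ∈ P ∧ (A₂, B₂) ∈ P)) ∧
  ∀ p₁ ∈ P, ∀ p₂ ∈ P, (p₁.2 ∩ p₂.2, p₁.1 ∪ p₂.1) ∉ P

/-- A regular profile: a profile containing no separation of the form `(V,B)`. -/
def IsRegularProfile {V : Type*} [Fintype V] [DecidableEq V] (ord : Finset V → Finset V → ℚ)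
    (k : ℚ) (P : Set (Finset V × Finset V)) : Prop :=
  IsProfile ord k P ∧ ∀ B : Finset V, (univ, B) ∉ P

/-- `^▷τ`: the separations `(C,D)` of `Y` whose shift `(C,D)^◁` lies in `τ`. -/
def pullY (R : X → Y → Prop) [∀ x y, Decidable (R x y)] (τ : Set (Finset X × Finset X)) :
    Set (Finset Y × Finset Y) :=
  {q | q.1 ∪ q.2 = univ ∧ (shiftL1 R q.1 q.2, shiftL2 R q.1 q.2) ∈ τ}

/-- `^◁τ`: the separations `(A,B)` of `X` whose shift `(A,B)^▷` lies in `τ`. -/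
def pullX (R : X → Y → Prop) [∀ x y, Decidable (R x y)] (τ : Set (Finset Y × Finset Y)) :
    Set (Finset X × Finset X) :=
  {p | p.1 ∪ p.2 = univ ∧ (shiftR1 R p.1 p.2, shiftR2 R p.1 p.2) ∈ τ}

/-- `τ_E`: the separations `(C,D)` of `E` whose shift `(C,D)^◀` lies in `τ`. -/
def pullE (R : X → Y → Prop) [∀ x y, Decidable (R x y)] (τ : Set (Finset X × Finset X)) :
    Set (Finset (Edge R) × Finset (Edge R)) :=
  {q | q.1 ∪ q.2 = univ ∧ (bshift1 R q.1 q.2, bshift2 R q.1 q.2) ∈ τ}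

/-- `τ_X := {(C,D)^◀ : (C,D) ∈ τ}`. -/
def pushX (R : X → Y → Prop) [∀ x y, Decidable (R x y)]
    (τ : Set (Finset (Edge R) × Finset (Edge R))) : Set (Finset X × Finset X) :=
  {p | ∃ q ∈ τ, (bshift1 R q.1 q.2, bshift2 R q.1 q.2) = p}


set_option linter.unusedSectionVars false

theorem nX_mono (R : X → Y → Prop) [∀ x y, Decidable (R x y)] (y : Y) {A B : Finset X}
    (h : A ⊆ B) : nX R y A ≤ nX R y B :=
  card_le_card (filter_subset_filter _ h)

/-- Double counting of the edges between `Z` and `D`. -/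
theorem sum_nY_eq_sum_nX (R : X → Y → Prop) [∀ x y, Decidable (R x y)]
    (Z : Finset X) (D : Finset Y) : ∑ x ∈ Z, nY R x D = ∑ y ∈ D, nX R y Z :=
  sum_card_bipartiteAbove_eq_sum_card_bipartiteBelow R

theorem nY_univ_le_add (R : X → Y → Prop) [∀ x y, Decidable (R x y)] (x : X)
    {C D : Finset Y} (h : C ∪ D = univ) : nY R x univ ≤ nY R x C + nY R x D := by
  rw [← h, nY, filter_union]
  exact card_union_le _ _

theorem ordX_comm (R : X → Y → Prop) [∀ x y, Decidable (R x y)] (A B : Finset X) :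
    ordX R A B = ordX R B A := by
  simp only [ordX, min_comm, inter_comm]

theorem ordX_univ_right (R : X → Y → Prop) [∀ x y, Decidable (R x y)] (Z : Finset X) :
    ordX R Z univ = ((∑ y : Y, nX R y Z : ℕ) : ℚ) / 2 := by
  rw [ordX, Nat.cast_sum, sum_div]
  refine sum_congr rfl fun y _ => ?_
  have h : (nX R y Z : ℚ) ≤ nX R y univ := by exact_mod_cast nX_mono R y (subset_univ Z)
  rw [min_eq_left h, inter_univ]
  ring

/-- The edges between `A \ B` and the second side of the shift of `(A,B)` are at most as many
as the order of `(A,B)`. -/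
theorem sum_nX_sdiff_le_ordX (R : X → Y → Prop) [∀ x y, Decidable (R x y)] (A B : Finset X) :
    ((∑ y ∈ shiftR2 R A B, nX R y (A \ B) : ℕ) : ℚ) ≤ ordX R A B := by
  rw [Nat.cast_sum, shiftR2, sum_filter, ordX]
  refine sum_le_sum fun y _ => ?_
  have hA : (nX R y (A ∩ B) : ℚ) ≤ nX R y A := by
    exact_mod_cast nX_mono R y inter_subset_left
  have hB : (nX R y (A ∩ B) : ℚ) ≤ nX R y B := by
    exact_mod_cast nX_mono R y inter_subset_right
  have h0 : (0 : ℚ) ≤ nX R y (A ∩ B) := Nat.cast_nonneg _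
  split_ifs with h
  · have hsum : (nX R y (A \ B) : ℚ) + nX R y (A ∩ B) = nX R y A := by
      have : nX R y (A \ B) + nX R y (A ∩ B) = nX R y A := by
        unfold nX
        rw [← card_union_of_disjoint
          (disjoint_filter_filter (disjoint_sdiff_inter A B)), ← filter_union,
          sdiff_union_inter]
      exact_mod_cast this
    rw [min_eq_left (by exact_mod_cast h)]
    linarith
  · have := le_min hA hB
    linarith

/-- Shifting `(A,B)` to `Y` and back, few edges are incident with the vertices of `A \ B` that
are not in the first side of the resulting separation. -/
theorem ordX_compl_union_shift_le (R : X → Y → Prop) [∀ x y, Decidable (R x y)]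
    (A B : Finset X) (hAB : A ∪ B = univ)
    (hCD : shiftR1 R A B ∪ shiftR2 R A B = univ) :
    ordX R (B ∪ shiftL1 R (shiftR1 R A B) (shiftR2 R A B))ᶜ univ ≤ ordX R A B := by
  set D := shiftR2 R A B with hD
  set Z := (B ∪ shiftL1 R (shiftR1 R A B) D)ᶜ with hZ
  have hZA : Z ⊆ A \ B := by
    intro x hx
    have hxB : x ∉ B := fun h => mem_compl.1 hx (mem_union_left _ h)
    have hxAB : x ∈ A ∪ B := hAB ▸ mem_univ x
    exact mem_sdiff.2 ⟨(mem_union.1 hxAB).resolve_right hxB, hxB⟩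
  have hcount : ∑ y : Y, nX R y Z ≤ 2 * ∑ y ∈ D, nX R y (A \ B) := calc
    ∑ y : Y, nX R y Z = ∑ x ∈ Z, nY R x univ := (sum_nY_eq_sum_nX R Z univ).symm
    _ ≤ ∑ x ∈ Z, 2 * nY R x D := sum_le_sum fun x hx => by
      have hlt : ¬ nY R x D ≤ nY R x (shiftR1 R A B) := fun h =>
        mem_compl.1 hx (mem_union_right _ (mem_filter.2 ⟨mem_univ x, h⟩))
      have := nY_univ_le_add R x hCD
      omega
    _ = 2 * ∑ y ∈ D, nX R y Z := by rw [← mul_sum, sum_nY_eq_sum_nX]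
    _ ≤ 2 * ∑ y ∈ D, nX R y (A \ B) :=
      Nat.mul_le_mul_left _ (sum_le_sum fun y _ => nX_mono R y hZA)
  have hcount' : ((∑ y : Y, nX R y Z : ℕ) : ℚ) ≤ 2 * ((∑ y ∈ D, nX R y (A \ B) : ℕ) : ℚ) := by
    exact_mod_cast hcount
  have := sum_nX_sdiff_le_ordX R A B
  rw [ordX_univ_right]
  linarith

/-- Shifting a tangle of `S_{64k}(X)` to `Y` and back yields a restriction of the
original tangle. -/
theorem tangle_double_shift_weaker (R : X → Y → Prop) [∀ x y, Decidable (R x y)]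
    (k : ℚ) (hk : 0 < k)
    (hdegX : ∀ x : X, ∃ y : Y, R x y) (hdegY : ∀ y : Y, ∃ x : X, R x y)
    (hE : 128 * k ≤ (Fintype.card (Edge R) : ℚ))
    (τ : Set (Finset X × Finset X)) (hτ : IsTangle (ordX R) (64 * k) τ) :
    pullX R (pullY R τ ∩ Sk (ordY R) (8 * k)) ∩ Sk (ordX R) k ⊆ τ := by
  rintro ⟨A, B⟩ ⟨⟨hAB, ⟨hCD, hshift⟩, -⟩, -, hord⟩
  obtain ⟨-, horient, hcover⟩ := hτ
  dsimp only at hAB hCD hshift hord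
  by_contra hnot
  have hBA : (B, A) ∈ τ := by
    rw [horient B A (by rwa [union_comm]) (by rw [ordX_comm]; linarith)]
    exact hnot
  set Z := (B ∪ shiftL1 R (shiftR1 R A B) (shiftR2 R A B))ᶜ with hZ
  have hZτ : (Z, univ) ∈ τ := by
    have hle := ordX_compl_union_shift_le R A B hAB hCD
    rw [horient Z univ (by simp) (by linarith)]
    intro h
    exact hcover _ h _ h _ h (by simp)
  exact hcover _ hBA _ hshift _ hZτ (by simp only [hZ, union_compl])

end BipSep
end

section
/- Let k > 0, assume that every vertex of G is incident with at least one edge and that G has at least 32k edges. Let τ be a tangle of S_{16k}(X). Then (τ ∩ S_k(X))^▷ ⊆ ^▷τ, where (τ ∩ S_k(X))^▷ := {(A,B)^▷ : (A,B) ∈ τ ∩ S_k(X)}. -/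
open Finset

namespace BipSep

variable {X Y : Type*} [Fintype X] [Fintype Y] [DecidableEq X] [DecidableEq Y]

/-- The weight of a vertex with respect to a separation: `1` on `A \ B`, `-1` on `B \ A`
and `0` on `A ∩ B`. -/
def sepWeight {V : Type*} [DecidableEq V] (A B : Finset V) (v : V) : ℚ :=
  (if v ∈ A then 1 else 0) - (if v ∈ B then 1 else 0)

lemma abs_sepWeight_le_one {V : Type*} [DecidableEq V] (A B : Finset V) (v : V) :
    |sepWeight A B v| ≤ 1 := by
  unfold sepWeight
  split_ifs <;> norm_num

lemma nX_eq_sum (R : X → Y → Prop) [∀ x y, Decidable (R x y)] (y : Y) (A : Finset X) :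
    (nX R y A : ℚ) = ∑ x, if R x y then (if x ∈ A then 1 else 0) else 0 := by
  have h : A.filter (fun x => R x y) = univ.filter fun x => R x y ∧ x ∈ A := by
    ext x
    simp [and_comm]
  rw [nX, h, card_filter]
  push_cast
  simp only [ite_and]

lemma nX_sub_nX (R : X → Y → Prop) [∀ x y, Decidable (R x y)] (y : Y) (A B : Finset X) :
    (nX R y A : ℚ) - nX R y B = ∑ x, if R x y then sepWeight A B x else 0 := by
  rw [nX_eq_sum, nX_eq_sum, ← sum_sub_distrib]
  refine sum_congr rfl fun x _ => ?_
  by_cases h : R x y <;> simp [h, sepWeight]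

lemma nX_add_nX (R : X → Y → Prop) [∀ x y, Decidable (R x y)] (y : Y) {A B : Finset X}
    (h : A ∪ B = univ) :
    (nX R y A : ℚ) + nX R y B = nX R y univ + nX R y (A ∩ B) := by
  rw [← h]
  unfold nX
  rw [filter_union, filter_inter_distrib]
  exact_mod_cast (card_union_add_card_inter _ _).symm

lemma two_mul_ordX (R : X → Y → Prop) [∀ x y, Decidable (R x y)] {A B : Finset X}
    (h : A ∪ B = univ) :
    2 * ordX R A B = ∑ y, ((nX R y univ : ℚ) - |(nX R y A : ℚ) - nX R y B|) := by
  rw [ordX, mul_sum]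
  refine sum_congr rfl fun y _ => ?_
  have h₁ := nX_add_nX R y h
  rcases le_total (nX R y A : ℚ) (nX R y B) with h₂ | h₂
  · rw [min_eq_left h₂, abs_of_nonpos (by linarith)]
    linarith
  · rw [min_eq_right h₂, abs_of_nonneg (by linarith)]
    linarith

lemma nX_univ_sub_mul (R : X → Y → Prop) [∀ x y, Decidable (R x y)] (y : Y) (A B : Finset X)
    (s : ℚ) :
    (nX R y univ : ℚ) - s * ((nX R y A : ℚ) - nX R y B) =
      ∑ x, if R x y then 1 - s * sepWeight A B x else 0 := by
  rw [nX_sub_nX, nX_eq_sum, mul_sum, ← sum_sub_distrib]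
  refine sum_congr rfl fun x _ => ?_
  by_cases h : R x y <;> simp [h]

/-- Any weighting of `Y` with values in `[-1, 1]` bounds the order of a separation of `X`. -/
lemma two_mul_ordX_le (R : X → Y → Prop) [∀ x y, Decidable (R x y)] {A B : Finset X}
    (h : A ∪ B = univ) (s : Y → ℚ) (hs : ∀ y, |s y| ≤ 1) :
    2 * ordX R A B ≤ ∑ y, ∑ x, if R x y then 1 - s y * sepWeight A B x else 0 := by
  rw [two_mul_ordX R h]
  refine sum_le_sum fun y _ => ?_
  rw [← nX_univ_sub_mul]
  have h₁ := le_abs_self (s y * ((nX R y A : ℚ) - nX R y B))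
  rw [abs_mul] at h₁
  have h₂ := mul_le_of_le_one_left (abs_nonneg ((nX R y A : ℚ) - nX R y B)) (hs y)
  linarith

/-- The weighting of `Y` given by the shift attains the bound in `two_mul_ordX_le`. -/
lemma two_mul_ordX_eq (R : X → Y → Prop) [∀ x y, Decidable (R x y)] {A B : Finset X}
    (h : A ∪ B = univ) :
    2 * ordX R A B = ∑ y, ∑ x, if R x y then
      1 - sepWeight (shiftR1 R A B) (shiftR2 R A B) y * sepWeight A B x else 0 := by
  rw [two_mul_ordX R h]
  refine sum_congr rfl fun y _ => ?_
  rw [← nX_univ_sub_mul]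
  congr 1
  simp only [sepWeight, shiftR1, shiftR2, mem_filter, mem_univ, true_and]
  rcases lt_trichotomy (nX R y A) (nX R y B) with h₁ | h₁ | h₁
  · have h₂ : (nX R y A : ℚ) < nX R y B := by exact_mod_cast h₁
    rw [if_neg h₁.not_ge, if_pos h₁.le, abs_of_neg (by linarith)]
    ring
  · simp [h₁]
  · have h₂ : (nX R y B : ℚ) < nX R y A := by exact_mod_cast h₁
    rw [if_pos h₁.le, if_neg h₁.not_ge, abs_of_pos (by linarith)]
    ring

lemma shiftR1_union_shiftR2 (R : X → Y → Prop) [∀ x y, Decidable (R x y)] (A B : Finset X) :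
    shiftR1 R A B ∪ shiftR2 R A B = univ := by
  ext y
  simpa [shiftR1, shiftR2] using le_total (nX R y B) (nX R y A)

lemma shiftL1_union_shiftL2 (R : X → Y → Prop) [∀ x y, Decidable (R x y)] (C D : Finset Y) :
    shiftL1 R C D ∪ shiftL2 R C D = univ :=
  shiftR1_union_shiftR2 (fun y x => R x y) C D

/-- Shifting a separation of `X` does not increase its order. -/
lemma ordY_shiftR_le (R : X → Y → Prop) [∀ x y, Decidable (R x y)] {A B : Finset X}
    (h : A ∪ B = univ) :
    ordY R (shiftR1 R A B) (shiftR2 R A B) ≤ ordX R A B := by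
  have h₁ : 2 * ordY R (shiftR1 R A B) (shiftR2 R A B) ≤ _ :=
    two_mul_ordX_le (fun y x => R x y) (shiftR1_union_shiftR2 R A B) (sepWeight A B)
      (abs_sepWeight_le_one A B)
  have h₂ := two_mul_ordX_eq R h
  rw [sum_comm] at h₂
  simp only [mul_comm (sepWeight A B _)] at h₁
  linarith

/-- Shifting a separation of `Y` does not increase its order. -/
lemma ordX_shiftL_le (R : X → Y → Prop) [∀ x y, Decidable (R x y)] {C D : Finset Y}
    (h : C ∪ D = univ) :
    ordX R (shiftL1 R C D) (shiftL2 R C D) ≤ ordY R C D :=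
  ordY_shiftR_le (fun y x => R x y) h

/-- The order of `(Z, X)` is half the number of edges incident with `Z`. -/
lemma two_mul_ordX_univ (R : X → Y → Prop) [∀ x y, Decidable (R x y)] (Z : Finset X) :
    2 * ordX R Z univ = ∑ y, (nX R y Z : ℚ) := by
  rw [ordX, mul_sum]
  refine sum_congr rfl fun y _ => ?_
  have h : (nX R y Z : ℚ) ≤ nX R y univ := by
    exact_mod_cast card_le_card (filter_subset_filter _ (subset_univ Z))
  rw [min_eq_left h, inter_univ]
  ring

lemma nX_eq_sum_mem (R : X → Y → Prop) [∀ x y, Decidable (R x y)] (y : Y) (Z : Finset X) :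
    (nX R y Z : ℚ) = ∑ x ∈ Z, if R x y then 1 else 0 := by
  rw [nX, card_filter]
  push_cast
  rfl

/-- The vertices outside `A` which the double shift of `(A, B)` moves strictly to the side
of `A` are incident with few edges. -/
lemma ordX_moved_le (R : X → Y → Prop) [∀ x y, Decidable (R x y)] {A B : Finset X}
    (h : A ∪ B = univ) {Z : Finset X} (hA : ∀ x ∈ Z, x ∉ A)
    (hZ : ∀ x ∈ Z, nY R x (shiftR2 R A B) ≤ nY R x (shiftR1 R A B)) :
    ordX R Z univ ≤ ordX R A B := by
  set s := sepWeight (shiftR1 R A B) (shiftR2 R A B) with hs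
  have h₁ := two_mul_ordX_eq R h
  rw [sum_comm] at h₁
  have h₂ := two_mul_ordX_univ R Z
  simp only [nX_eq_sum_mem] at h₂
  rw [sum_comm] at h₂
  have h₃ : ∀ x y, 0 ≤ if R x y then 1 - s y * sepWeight A B x else 0 := by
    intro x y
    split_ifs
    · have h₄ := le_abs_self (s y * sepWeight A B x)
      rw [abs_mul] at h₄
      have h₅ := mul_le_one₀ (abs_sepWeight_le_one (shiftR1 R A B) (shiftR2 R A B) y)
        (abs_nonneg _) (abs_sepWeight_le_one A B x)
      linarith
    · exact le_rfl
  have h₄ : ∑ x ∈ Z, ∑ y, (if R x y then (1 : ℚ) else 0) ≤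
      ∑ x ∈ Z, ∑ y, if R x y then 1 - s y * sepWeight A B x else 0 := by
    refine sum_le_sum fun x hx => ?_
    have hw : sepWeight A B x = -1 := by
      have hB : x ∈ A ∪ B := h ▸ mem_univ x
      have hxB : x ∈ B := (mem_union.mp hB).resolve_left (hA x hx)
      simp [sepWeight, hA x hx, hxB]
    have h₅ : (nY R x (shiftR1 R A B) : ℚ) - nY R x (shiftR2 R A B) =
        ∑ y, if R x y then s y else 0 :=
      nX_sub_nX (fun y x => R x y) x _ _
    have h₆ : (nY R x (shiftR2 R A B) : ℚ) ≤ nY R x (shiftR1 R A B) := by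
      exact_mod_cast hZ x hx
    have h₇ : ∑ y, (if R x y then 1 - s y * sepWeight A B x else 0) =
        ∑ y, (if R x y then (1 : ℚ) else 0) + ∑ y, if R x y then s y else 0 := by
      rw [← sum_add_distrib]
      refine sum_congr rfl fun y _ => ?_
      split_ifs <;> simp [hw]
    linarith
  have h₅ : ∑ x ∈ Z, ∑ y, (if R x y then 1 - s y * sepWeight A B x else 0) ≤
      ∑ x, ∑ y, if R x y then 1 - s y * sepWeight A B x else 0 :=
    sum_le_sum_of_subset_of_nonneg (subset_univ Z) fun x _ _ => sum_nonneg fun y _ => h₃ x y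
  linarith

/-- A tangle contains every separation `(Z, V)` of sufficiently small order. -/
lemma IsTangle.mem_univ_right {V : Type*} [Fintype V] [DecidableEq V]
    {ord : Finset V → Finset V → ℚ} {k : ℚ} {τ : Set (Finset V × Finset V)}
    (hτ : IsTangle ord k τ) {Z : Finset V} (hZ : ord Z univ < k) : (Z, univ) ∈ τ := by
  rw [hτ.2.1 Z univ (by simp) hZ]
  exact fun h => hτ.2.2 _ h _ h _ h (by simp)

/-- The push-forward of the low-order part of a tangle of `S_{16k}(X)` is contained in its
pull-back `^▷τ`. -/
theorem push_subset_pull (R : X → Y → Prop) [∀ x y, Decidable (R x y)] (k : ℚ) (hk : 0 < k)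
    (hdegX : ∀ x : X, ∃ y : Y, R x y) (hdegY : ∀ y : Y, ∃ x : X, R x y)
    (hE : 32 * k ≤ (Fintype.card (Edge R) : ℚ))
    (τ : Set (Finset X × Finset X)) (hτ : IsTangle (ordX R) (16 * k) τ) :
    {q : Finset Y × Finset Y |
        ∃ p ∈ τ ∩ Sk (ordX R) k, (shiftR1 R p.1 p.2, shiftR2 R p.1 p.2) = q} ⊆
      pullY R τ := by
  rintro _ ⟨⟨A, B⟩, ⟨hAB, hcov, hord⟩, rfl⟩
  refine ⟨shiftR1_union_shiftR2 R A B, ?_⟩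
  have hA' : ordX R (shiftL1 R (shiftR1 R A B) (shiftR2 R A B))
      (shiftL2 R (shiftR1 R A B) (shiftR2 R A B)) < 16 * k := by
    have h₁ := ordX_shiftL_le R (shiftR1_union_shiftR2 R A B)
    have h₂ := ordY_shiftR_le R hcov
    dsimp only at hord h₂
    linarith
  rw [hτ.2.1 _ _ (shiftL1_union_shiftL2 R _ _) hA']
  intro hB'
  set Z := univ \ (A ∪ shiftL2 R (shiftR1 R A B) (shiftR2 R A B)) with hZ
  have hZord : ordX R Z univ ≤ ordX R A B := by
    refine ordX_moved_le R hcov (fun x hx hxA => ?_) fun x hx => ?_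
    · simp [hZ, hxA] at hx
    · simp only [hZ, shiftL2, mem_sdiff, mem_union, mem_filter, mem_univ, true_and, not_or,
        not_le] at hx
      exact hx.2.le
  have hZτ : (Z, univ) ∈ τ := by
    refine hτ.mem_univ_right ?_
    dsimp only at hord
    linarith
  exact hτ.2.2 _ hAB _ hB' _ hZτ (union_sdiff_of_subset (subset_univ _))

end BipSep
end
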